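/- Let k be a field and q ∈ k^* an element admitting a square root in k. Let a = a_1 h^i with a_1 ∈ k^* and i ∈ ℤ be a monomial in k[h^{±1}]. Then the generalized Weyl algebras k[h^{±1}](σ', a) and k[h^{±1}](σ, a), where σ'(h) = q h^{-1} and σ(h) = h^{-1}, are isomorphic as k-algebras; an isomorphism Γ is given on generators by Γ(h̄) = q^{1/2} h, Γ(x̄) = q^{i/2} x, Γ(ȳ) = y. -/

import Mathlib

open LaurentPolynomial

/-- The defining relations of the degree-one generalized Weyl algebra `k[h^{±1}](σ, a)`:
the generators `Sum.inl p` (for `p` a Laurent polynomial) give a copy of `k[h^{±1}]`,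
and the generators `x = Sum.inr 0` and `y = Sum.inr 1` satisfy
`y x = a`, `x y = σ a`, `x r = σ(r) x` and `y r = σ⁻¹(r) y` for all `r ∈ k[h^{±1}]`. -/
inductive GWARel (k : Type*) [CommRing k] (σ : LaurentPolynomial k ≃ₐ[k] LaurentPolynomial k)
    (a : LaurentPolynomial k) :
    FreeAlgebra k (LaurentPolynomial k ⊕ Fin 2) →
      FreeAlgebra k (LaurentPolynomial k ⊕ Fin 2) → Prop
  | add (r s : LaurentPolynomial k) :
      GWARel k σ a (FreeAlgebra.ι k (Sum.inl (r + s)))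
        (FreeAlgebra.ι k (Sum.inl r) + FreeAlgebra.ι k (Sum.inl s))
  | mul (r s : LaurentPolynomial k) :
      GWARel k σ a (FreeAlgebra.ι k (Sum.inl (r * s)))
        (FreeAlgebra.ι k (Sum.inl r) * FreeAlgebra.ι k (Sum.inl s))
  | smul (c : k) (r : LaurentPolynomial k) :
      GWARel k σ a (FreeAlgebra.ι k (Sum.inl (c • r))) (c • FreeAlgebra.ι k (Sum.inl r))
  | one : GWARel k σ a (FreeAlgebra.ι k (Sum.inl 1)) 1
  | xr (r : LaurentPolynomial k) :
      GWARel k σ a (FreeAlgebra.ι k (Sum.inr 0) * FreeAlgebra.ι k (Sum.inl r))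
        (FreeAlgebra.ι k (Sum.inl (σ r)) * FreeAlgebra.ι k (Sum.inr 0))
  | yr (r : LaurentPolynomial k) :
      GWARel k σ a (FreeAlgebra.ι k (Sum.inr 1) * FreeAlgebra.ι k (Sum.inl r))
        (FreeAlgebra.ι k (Sum.inl (σ.symm r)) * FreeAlgebra.ι k (Sum.inr 1))
  | yx : GWARel k σ a (FreeAlgebra.ι k (Sum.inr 1) * FreeAlgebra.ι k (Sum.inr 0))
        (FreeAlgebra.ι k (Sum.inl a))
  | xy : GWARel k σ a (FreeAlgebra.ι k (Sum.inr 0) * FreeAlgebra.ι k (Sum.inr 1))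
        (FreeAlgebra.ι k (Sum.inl (σ a)))

/-- The degree-one generalized Weyl algebra `k[h^{±1}](σ, a)`, presented as the quotient of
the free algebra on `k[h^{±1}] ⊕ {x, y}` by the generalized Weyl relations. -/
abbrev GWA (k : Type*) [CommRing k] (σ : LaurentPolynomial k ≃ₐ[k] LaurentPolynomial k)
    (a : LaurentPolynomial k) :=
  RingQuot (GWARel k σ a)

namespace GWA

variable {k : Type*} [CommRing k] (σ : LaurentPolynomial k ≃ₐ[k] LaurentPolynomial k)
  (a : LaurentPolynomial k)

/-- The copy of the Laurent polynomial `p` inside the generalized Weyl algebra. -/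
noncomputable def r (p : LaurentPolynomial k) : GWA k σ a :=
  RingQuot.mkAlgHom k (GWARel k σ a) (FreeAlgebra.ι k (Sum.inl p))

/-- The element `h` of the generalized Weyl algebra. -/
noncomputable def H : GWA k σ a := r σ a (T 1)

/-- The element `h⁻¹` of the generalized Weyl algebra. -/
noncomputable def Hinv : GWA k σ a := r σ a (T (-1))

/-- The generator `x` of the generalized Weyl algebra. -/
noncomputable def x : GWA k σ a :=
  RingQuot.mkAlgHom k (GWARel k σ a) (FreeAlgebra.ι k (Sum.inr 0))

/-- The generator `y` of the generalized Weyl algebra. -/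
noncomputable def y : GWA k σ a :=
  RingQuot.mkAlgHom k (GWARel k σ a) (FreeAlgebra.ι k (Sum.inr 1))

end GWA

/-- An element `a ∈ k[h^{±1}]` is a monomial if `a = c·hⁱ` for some `c ∈ k`, `i ∈ ℤ`. -/
def LaurentPolynomial.IsMonomial {k : Type*} [CommRing k] (a : LaurentPolynomial k) : Prop :=
  ∃ (c : k) (i : ℤ), a = C c * T i

namespace LaurentPolynomial

variable {k : Type*} [CommRing k]

theorem algHom_ext_T_one {A : Type*} [Semiring A] [Algebra k A]
    {f g : LaurentPolynomial k →ₐ[k] A} (h : f (T 1) = g (T 1)) : f = g :=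
  (AddMonoidAlgebra.lift k A ℤ).symm.injective (MonoidHom.ext_mint h)

/-- The algebra endomorphism of `k[h^{±1}]` sending `h` to `u h`, for a unit `u` of `k`. -/
noncomputable def scaleHom (u : kˣ) : LaurentPolynomial k →ₐ[k] LaurentPolynomial k :=
  AddMonoidAlgebra.lift k _ ℤ
    { toFun := fun n => C ((u ^ n.toAdd : kˣ) : k) * T n.toAdd
      map_one' := by simp
      map_mul' := fun m n => by
        simp only [toAdd_mul, zpow_add, Units.val_mul, map_mul, T_add]
        ring }

@[simp]
theorem scaleHom_T (u : kˣ) (n : ℤ) : scaleHom u (T n) = C ((u ^ n : kˣ) : k) * T n :=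
  (AddMonoidAlgebra.lift_single _ _ _).trans (one_smul k _)

theorem algHom_C {A : Type*} [Semiring A] [Algebra k A] (f : LaurentPolynomial k →ₐ[k] A)
    (c : k) : f (C c) = algebraMap k A c := by
  rw [C_eq_algebraMap, AlgHom.commutes]

theorem scaleHom_comp_scaleHom_of_mul_eq_one {u v : kˣ} (h : u * v = 1) :
    (scaleHom u).comp (scaleHom v) = AlgHom.id k _ := by
  apply algHom_ext_T_one
  simp only [AlgHom.comp_apply, scaleHom_T, zpow_one, map_mul, algHom_C, ← C_eq_algebraMap,
    AlgHom.id_apply]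
  rw [← mul_assoc, ← map_mul, ← Units.val_mul, mul_comm v, h, Units.val_one, map_one, one_mul]

/-- The algebra automorphism of `k[h^{±1}]` sending `h` to `u h`, for a unit `u` of `k`. -/
noncomputable def scale (u : kˣ) : LaurentPolynomial k ≃ₐ[k] LaurentPolynomial k :=
  AlgEquiv.ofAlgHom (scaleHom u) (scaleHom u⁻¹)
    (scaleHom_comp_scaleHom_of_mul_eq_one (mul_inv_cancel u))
    (scaleHom_comp_scaleHom_of_mul_eq_one (inv_mul_cancel u))

@[simp]
theorem scale_T (u : kˣ) (n : ℤ) : scale u (T n) = C ((u ^ n : kˣ) : k) * T n :=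
  scaleHom_T u n

theorem algEquiv_C (f : LaurentPolynomial k ≃ₐ[k] LaurentPolynomial k) (c : k) :
    f (C c) = C c :=
  algHom_C f.toAlgHom c

end LaurentPolynomial

namespace GWA

variable {k : Type*} [CommRing k] (σ : LaurentPolynomial k ≃ₐ[k] LaurentPolynomial k)
  (a : LaurentPolynomial k)

theorem r_add (p p' : LaurentPolynomial k) : r σ a (p + p') = r σ a p + r σ a p' := by
  simpa [r] using RingQuot.mkAlgHom_rel k (GWARel.add (σ := σ) (a := a) p p')

theorem r_mul (p p' : LaurentPolynomial k) : r σ a (p * p') = r σ a p * r σ a p' := by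
  simpa [r] using RingQuot.mkAlgHom_rel k (GWARel.mul (σ := σ) (a := a) p p')

theorem r_smul (c : k) (p : LaurentPolynomial k) : r σ a (c • p) = c • r σ a p := by
  simpa [r] using RingQuot.mkAlgHom_rel k (GWARel.smul (σ := σ) (a := a) c p)

theorem r_one : r σ a 1 = 1 := by
  simpa [r] using RingQuot.mkAlgHom_rel k (GWARel.one (σ := σ) (a := a))

theorem x_mul_r (p : LaurentPolynomial k) : x σ a * r σ a p = r σ a (σ p) * x σ a := by
  simpa [r, x] using RingQuot.mkAlgHom_rel k (GWARel.xr (σ := σ) (a := a) p)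

theorem y_mul_r (p : LaurentPolynomial k) : y σ a * r σ a p = r σ a (σ.symm p) * y σ a := by
  simpa [r, y] using RingQuot.mkAlgHom_rel k (GWARel.yr (σ := σ) (a := a) p)

theorem y_mul_x : y σ a * x σ a = r σ a a := by
  simpa [r, x, y] using RingQuot.mkAlgHom_rel k (GWARel.yx (σ := σ) (a := a))

theorem x_mul_y : x σ a * y σ a = r σ a (σ a) := by
  simpa [r, x, y] using RingQuot.mkAlgHom_rel k (GWARel.xy (σ := σ) (a := a))

variable {σ a}

theorem hom_ext {B : Type*} [Semiring B] [Algebra k B] {f g : GWA k σ a →ₐ[k] B}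
    (hr : ∀ p, f (r σ a p) = g (r σ a p)) (hx : f (x σ a) = g (x σ a))
    (hy : f (y σ a) = g (y σ a)) : f = g := by
  refine RingQuot.ringQuot_ext' k f g (FreeAlgebra.hom_ext (funext fun t => ?_))
  rcases t with p | j
  · exact hr p
  · fin_cases j
    exacts [hx, hy]

variable {σ' : LaurentPolynomial k ≃ₐ[k] LaurentPolynomial k} {a' : LaurentPolynomial k}

/-- An automorphism `φ` of `k[h^{±1}]` intertwining `σ'` and `σ` with `φ a' = c a` induces an
algebra homomorphism `k[h^{±1}](σ', a') → k[h^{±1}](σ, a)` with `x ↦ c x` and `y ↦ y`. -/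
noncomputable def map (φ : LaurentPolynomial k ≃ₐ[k] LaurentPolynomial k) (c : k)
    (hφ : ∀ p, φ (σ' p) = σ (φ p)) (ha : φ a' = c • a) : GWA k σ' a' →ₐ[k] GWA k σ a :=
  RingQuot.liftAlgHom k ⟨FreeAlgebra.lift k
    (Sum.elim (fun p => r σ a (φ p)) ![c • x σ a, y σ a]), by
      intro u v huv
      induction huv with
      | add p p' => simp [r_add]
      | mul p p' => simp [r_mul]
      | smul c p => simp [r_smul]
      | one => simp [r_one]
      | xr p => simp [x_mul_r, hφ]
      | yr p =>
        have h : φ (σ'.symm p) = σ.symm (φ p) := by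
          rw [AlgEquiv.eq_symm_apply, ← hφ, AlgEquiv.apply_symm_apply]
        simp [y_mul_r, h]
      | yx => simp [y_mul_x, ha, r_smul]
      | xy => simp [x_mul_y, hφ, ha, r_smul]⟩

section map

variable (φ : LaurentPolynomial k ≃ₐ[k] LaurentPolynomial k) (c : k)
  (hφ : ∀ p, φ (σ' p) = σ (φ p)) (ha : φ a' = c • a)

@[simp]
theorem map_r (p : LaurentPolynomial k) : map φ c hφ ha (r σ' a' p) = r σ a (φ p) := by
  simp [map, r]

@[simp]
theorem map_x : map φ c hφ ha (x σ' a') = c • x σ a := by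
  simp [map, x]

@[simp]
theorem map_y : map φ c hφ ha (y σ' a') = y σ a := by
  simp [map, y]

end map

/-- When the scalar `c` is a unit, the homomorphism `GWA.map` is an isomorphism. -/
noncomputable def mapEquiv (φ : LaurentPolynomial k ≃ₐ[k] LaurentPolynomial k) (c : kˣ)
    (hφ : ∀ p, φ (σ' p) = σ (φ p)) (ha : φ a' = (c : k) • a) : GWA k σ' a' ≃ₐ[k] GWA k σ a :=
  AlgEquiv.ofAlgHom (map φ c hφ ha)
    (map φ.symm ((c⁻¹ : kˣ) : k)
      (fun p => by rw [AlgEquiv.symm_apply_eq, hφ, AlgEquiv.apply_symm_apply])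
      (by rw [AlgEquiv.symm_apply_eq, map_smul, ha, smul_smul, Units.inv_mul, one_smul]))
    (hom_ext (by simp) (by simp [smul_smul]) (by simp))
    (hom_ext (by simp) (by simp [smul_smul]) (by simp))

end GWA

/-- Let `q ∈ k^*` have a square root `s` in `k`, and let `a = a₁ hⁱ` be a
monomial with `a₁ ∈ k^*`.  Then `k[h^{±1}](σ', a)` with `σ'(h) = q h⁻¹` is isomorphic to
`k[h^{±1}](σ, a)` with `σ(h) = h⁻¹`, via `Γ(h̄) = q^{1/2} h`, `Γ(x̄) = q^{i/2} x`,
`Γ(ȳ) = y`. -/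
theorem involution_gwa_monomial_rescale (k : Type*) [Field k] (q : k) (hq0 : q ≠ 0)
    (s : k) (hs : s ^ 2 = q) (a₁ : k) (ha₁ : a₁ ≠ 0) (i : ℤ)
    (σ' : LaurentPolynomial k ≃ₐ[k] LaurentPolynomial k) (hσ' : σ' (T 1) = C q * T (-1))
    (σ : LaurentPolynomial k ≃ₐ[k] LaurentPolynomial k) (hσ : σ (T 1) = T (-1)) :
    ∃ Γ : GWA k σ' (C a₁ * T i) ≃ₐ[k] GWA k σ (C a₁ * T i),
      Γ (GWA.H σ' (C a₁ * T i)) = algebraMap k (GWA k σ (C a₁ * T i)) s *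
          GWA.H σ (C a₁ * T i) ∧
        Γ (GWA.x σ' (C a₁ * T i)) = algebraMap k (GWA k σ (C a₁ * T i)) (s ^ i) *
          GWA.x σ (C a₁ * T i) ∧
        Γ (GWA.y σ' (C a₁ * T i)) = GWA.y σ (C a₁ * T i) := by
  have hs0 : s ≠ 0 := by
    rintro rfl
    exact hq0 (by simp [← hs])
  let u : kˣ := Units.mk0 s hs0
  have hφ : ∀ p, scale u (σ' p) = σ (scale u p) := by
    have h : ((scale u).toAlgHom.comp σ'.toAlgHom) = σ.toAlgHom.comp (scale u).toAlgHom := by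
      apply algHom_ext_T_one
      change scale u (σ' (T 1)) = σ (scale u (T 1))
      rw [hσ', map_mul, algEquiv_C, scale_T, scale_T, map_mul, algEquiv_C, hσ, ← mul_assoc,
        ← map_mul]
      congr 2
      simp only [zpow_neg, zpow_one, ← hs, Units.val_inv_eq_inv_val, u, Units.val_mk0]
      field_simp
    exact fun p => DFunLike.congr_fun h p
  have ha : scale u (C a₁ * T i) = ((u ^ i : kˣ) : k) • (C a₁ * T i) := by
    rw [map_mul, algEquiv_C, scale_T, smul_eq_C_mul, mul_left_comm]
  refine ⟨GWA.mapEquiv (scale u) (u ^ i) hφ ha, ?_, ?_, ?_⟩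
  · change GWA.map _ _ hφ ha (GWA.r _ _ _) = _
    rw [GWA.map_r, scale_T, ← smul_eq_C_mul _ (T 1), GWA.r_smul, Algebra.smul_def]
    simp [u, GWA.H]
  · change GWA.map _ _ hφ ha _ = _
    rw [GWA.map_x, Algebra.smul_def]
    simp [u]
  · exact GWA.map_y _ _ hφ ha
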